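/- arXiv:1808.00690 — 3 statements merged into one kernel-verified Lean document; each statement's English description precedes it below -/
import Mathlib

section
/- Let Φ : ℝ³ → ℝ³ be a C² diffeomorphism with Jacobian F(x̂) = ∇Φ(x̂) and J(x̂) = det F(x̂) > 0, and let N̂ : ℝ³ → ℝ^{3×3} be continuously differentiable. Define the transformed matrix field N by N(Φ(x̂)) = J(x̂)⁻²·F(x̂)·N̂(x̂)·F(x̂)ᵀ. Then for every x̂, (div_x N)(Φ(x̂)) = J(x̂)⁻¹ · div_x̂( J⁻¹·F·N̂ )(x̂), where div of a matrix field is taken row-wise. -/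
open Matrix

/-- Jacobi's formula for the derivative of a `3 × 3` determinant. -/
theorem fderiv_det_fin_three {E : Type*} [NormedAddCommGroup E] [NormedSpace ℝ E]
    {F : E → Matrix (Fin 3) (Fin 3) ℝ} {x : E}
    (hF : ∀ i j, DifferentiableAt ℝ (fun y => F y i j) x) (v : E) :
    fderiv ℝ (fun y => (F y).det) x v =
      ∑ i, ∑ j, (F x).adjugate j i * fderiv ℝ (fun y => F y i j) x v := by
  have h := fun i j => (hF i j).hasFDerivAt
  simp only [Matrix.det_fin_three]
  have key := ((((((((h 0 0).mul (h 1 1)).mul (h 2 2)).sub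
    (((h 0 0).mul (h 1 2)).mul (h 2 1))).sub
    (((h 0 1).mul (h 1 0)).mul (h 2 2))).add
    (((h 0 1).mul (h 1 2)).mul (h 2 0))).add
    (((h 0 2).mul (h 1 0)).mul (h 2 1))).sub
    (((h 0 2).mul (h 1 1)).mul (h 2 0))).fderiv
  refine (DFunLike.congr_fun key v).trans ?_
  simp [Fin.sum_univ_three, Matrix.adjugate_fin_three]
  ring

/-- Contracting with the adjugate turns the derivatives of a Piola-transformed vector field into
the divergence of the field on the reference domain. Here `A` is the Jacobian, `H` its (symmetric)
derivative, `v` the reference field with derivative `V`, and `d` the derivative of `det A`. -/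
theorem trace_eq_of_mul_eq_piola {n R : Type*} [Fintype n] [DecidableEq n] [Field R]
    {A G V : Matrix n n R} {H : n → n → n → R} {v d : n → R} (hA : A.det ≠ 0)
    (hH : ∀ j k l, H j k l = H j l k)
    (hd : ∀ l, d l = ∑ i, ∑ j, A.adjugate j i * H i j l)
    (hG : G * A = A.det⁻¹ • (Matrix.of (fun j l => ∑ k, H j k l * v k) + A * V) -
      (A.det ^ 2)⁻¹ • vecMulVec (A *ᵥ v) d) :
    G.trace = A.det⁻¹ * V.trace := by
  have h₁ : (Matrix.of (fun j l => ∑ k, H j k l * v k) * A.adjugate).trace = v ⬝ᵥ d := by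
    simp only [Matrix.trace, Matrix.diag, Matrix.mul_apply, Matrix.of_apply, dotProduct, hd,
      Finset.sum_mul, Finset.mul_sum]
    rw [Finset.sum_congr rfl fun i _ => Finset.sum_comm, Finset.sum_comm]
    refine Finset.sum_congr rfl fun k _ => Finset.sum_congr rfl fun i _ =>
      Finset.sum_congr rfl fun l _ => ?_
    rw [hH i k l]
    ring
  have h₂ : (A * V * A.adjugate).trace = A.det * V.trace := by
    rw [Matrix.trace_mul_comm, ← Matrix.mul_assoc, Matrix.adjugate_mul]
    simp
  have h₃ : (vecMulVec (A *ᵥ v) d * A.adjugate).trace = A.det * (v ⬝ᵥ d) := by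
    rw [Matrix.trace_mul_comm, Matrix.mul_vecMulVec, Matrix.mulVec_mulVec, Matrix.adjugate_mul,
      Matrix.trace_vecMulVec, Matrix.smul_mulVec, Matrix.one_mulVec, smul_dotProduct, smul_eq_mul]
  have h₄ : A.det * G.trace = V.trace := by
    have := congrArg (fun M => (M * A.adjugate).trace) hG
    simp only [Matrix.mul_assoc G, Matrix.mul_adjugate, Matrix.sub_mul, Matrix.smul_mul,
      Matrix.add_mul, Matrix.trace_sub, Matrix.trace_smul, Matrix.trace_add, h₁, h₂, h₃,
      Matrix.mul_smul, Matrix.mul_one, smul_eq_mul] at this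
    rw [this]
    field_simp
    ring
  rw [← h₄, inv_mul_cancel_left₀ hA]

/-- Piola identity for vector fields: the contravariant transformation of `v` under a `C²` map `Φ`
has divergence `J⁻¹ div v`. -/
theorem div_piola {Φ : (Fin 3 → ℝ) → (Fin 3 → ℝ)} (hΦ : ContDiff ℝ 2 Φ)
    {F : (Fin 3 → ℝ) → Matrix (Fin 3) (Fin 3) ℝ}
    (hF : ∀ x i j, F x i j = fderiv ℝ Φ x (Pi.single j 1) i)
    {n v : (Fin 3 → ℝ) → Fin 3 → ℝ} {x : Fin 3 → ℝ} (hJ : (F x).det ≠ 0)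
    (hv : ∀ k, DifferentiableAt ℝ (fun y => v y k) x)
    (hn : ∀ j, DifferentiableAt ℝ (fun y => n y j) (Φ x))
    (hnv : ∀ y j, n (Φ y) j = ((F y).det)⁻¹ * ∑ k, F y j k * v y k) :
    ∑ j, fderiv ℝ (fun y => n y j) (Φ x) (Pi.single j 1) =
      ((F x).det)⁻¹ * ∑ k, fderiv ℝ (fun y => v y k) x (Pi.single k 1) := by
  have hd2 : DifferentiableAt ℝ (fderiv ℝ Φ) x :=
    (hΦ.fderiv_right (m := 1) (by norm_num)).differentiable (by norm_num) x
  have hFd : ∀ j k, HasFDerivAt (fun y => F y j k)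
      ((ContinuousLinearMap.proj (R := ℝ) (φ := fun _ : Fin 3 => ℝ) j).comp
        ((fderiv ℝ (fderiv ℝ Φ) x).flip (Pi.single k 1))) x := by
    intro j k
    simp only [hF]
    have h := hd2.hasFDerivAt.clm_apply
      (hasFDerivAt_const (Pi.single k (1 : ℝ) : Fin 3 → ℝ) x)
    have h' := (hasFDerivAt_pi'.1 h) j
    rwa [ContinuousLinearMap.comp_zero, zero_add] at h'
  have hFdiff := fun j k => (hFd j k).differentiableAt
  have hdet : DifferentiableAt ℝ (fun y => (F y).det) x := by
    simp only [Matrix.det_fin_three]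
    fun_prop
  have hsymm : IsSymmSndFDerivAt ℝ Φ x :=
    hΦ.contDiffAt.isSymmSndFDerivAt (by simp)
  refine trace_eq_of_mul_eq_piola (A := F x)
    (G := Matrix.of fun j m => fderiv ℝ (fun y => n y j) (Φ x) (Pi.single m 1))
    (V := Matrix.of fun k l => fderiv ℝ (fun y => v y k) x (Pi.single l 1))
    (H := fun j k l => fderiv ℝ (fun y => F y j k) x (Pi.single l 1))
    (v := v x) (d := fun l => fderiv ℝ (fun y => (F y).det) x (Pi.single l 1)) hJ ?_ ?_ ?_
  · intro j k l
    simp only [(hFd j _).fderiv]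
    simp [hsymm.eq (Pi.single k 1) (Pi.single l 1)]
  · exact fun l => fderiv_det_fin_three hFdiff _
  · ext j l
    have hchain : fderiv ℝ (fun y => n (Φ y) j) x (Pi.single l 1) =
        ∑ m, fderiv ℝ (fun y => n y j) (Φ x) (Pi.single m 1) * F x m l := by
      have hc := ((hn j).hasFDerivAt.comp x
        (hΦ.differentiable (by norm_num) x).hasFDerivAt).fderiv
      refine (DFunLike.congr_fun hc _).trans ?_
      rw [ContinuousLinearMap.comp_apply,
        pi_eq_sum_univ' (fderiv ℝ Φ x (Pi.single l 1)), map_sum]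
      refine Finset.sum_congr rfl fun m _ => ?_
      rw [map_smul, hF, smul_eq_mul, mul_comm]
    have hprod : fderiv ℝ (fun y => n (Φ y) j) x (Pi.single l 1) =
        (F x).det⁻¹ * ∑ k, (fderiv ℝ (fun y => F y j k) x (Pi.single l 1) * v x k +
          F x j k * fderiv ℝ (fun y => v y k) x (Pi.single l 1)) -
        ((F x).det ^ 2)⁻¹ * ((∑ k, F x j k * v x k) *
          fderiv ℝ (fun y => (F y).det) x (Pi.single l 1)) := by
      simp only [hnv]
      have hi := (hasDerivAt_inv hJ).comp_hasFDerivAt x hdet.hasFDerivAt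
      have hs := HasFDerivAt.fun_sum (u := Finset.univ) fun k _ =>
        (hFdiff j k).hasFDerivAt.mul (hv k).hasFDerivAt
      refine (DFunLike.congr_fun (hi.mul hs).fderiv _).trans ?_
      simp [Fin.sum_univ_three]
      ring
    simp only [Matrix.mul_apply, Matrix.of_apply, Matrix.sub_apply, Matrix.smul_apply,
      Matrix.add_apply, vecMulVec_apply, Matrix.mulVec, dotProduct, smul_eq_mul,
      ← Finset.sum_add_distrib]
    rw [← hchain, hprod]

/-- Piola-type transformation rule for the divergence of the TDNNS stress
transformation N∘Φ = J⁻²·F·N̂·Fᵀ: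
(div_x N)(Φ(x̂)) = J⁻¹ · div_x̂(J⁻¹·F·N̂)(x̂). -/
theorem stmt7 (Φ Ψ : (Fin 3 → ℝ) → (Fin 3 → ℝ))
    (hΦ : ContDiff ℝ 2 Φ) (hΨ : ContDiff ℝ 2 Ψ)
    (hleft : Function.LeftInverse Ψ Φ) (hright : Function.RightInverse Ψ Φ)
    (F : (Fin 3 → ℝ) → Matrix (Fin 3) (Fin 3) ℝ)
    (hF : ∀ x i j, F x i j = fderiv ℝ Φ x (Pi.single j 1) i)
    (hJ : ∀ x, 0 < (F x).det)
    (Nhat : (Fin 3 → ℝ) → Matrix (Fin 3) (Fin 3) ℝ)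
    (hNhat : ContDiff ℝ 1 fun x => Matrix.of.symm (Nhat x))
    (N : (Fin 3 → ℝ) → Matrix (Fin 3) (Fin 3) ℝ)
    (hN : ∀ x, N (Φ x) = (((F x).det) ^ 2)⁻¹ • (F x * Nhat x * (F x)ᵀ))
    (x : Fin 3 → ℝ) :
    (fun i => ∑ j, fderiv ℝ (fun y => N y i j) (Φ x) (Pi.single j 1)) =
      fun i => ((F x).det)⁻¹ *
        ∑ j, fderiv ℝ (fun y => (((F y).det)⁻¹ • (F y * Nhat y)) i j) x
          (Pi.single j 1) := by
  have hFd : ∀ i j, Differentiable ℝ (fun y => F y i j) := by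
    intro i j
    simp only [hF]
    have hd : Differentiable ℝ (fderiv ℝ Φ) :=
      (hΦ.fderiv_right (m := 1) (by norm_num)).differentiable (by norm_num)
    fun_prop
  have hdet : Differentiable ℝ (fun y => (F y).det) := by
    simp only [Matrix.det_fin_three]
    fun_prop
  have hJ' : ∀ y, (F y).det ≠ 0 := fun y => (hJ y).ne'
  have hNd : ∀ i j, Differentiable ℝ (fun y => Nhat y i j) := fun i j =>
    differentiable_pi.1 (differentiable_pi.1 (hNhat.differentiable (by norm_num)) i) j
  have hu : ∀ i k, Differentiable ℝ (fun y => (((F y).det)⁻¹ • (F y * Nhat y)) i k) := by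
    intro i k
    simp only [Matrix.smul_apply, Matrix.mul_apply, smul_eq_mul]
    exact (hdet.inv hJ').mul (by fun_prop)
  have hN' : ∀ y i j, N (Φ y) i j =
      ((F y).det)⁻¹ * ∑ k, F y j k * (((F y).det)⁻¹ • (F y * Nhat y)) i k := by
    intro y i j
    rw [hN]
    simp only [Matrix.smul_apply, Matrix.mul_apply (N := (F y)ᵀ), Matrix.transpose_apply,
      smul_eq_mul, Finset.mul_sum]
    refine Finset.sum_congr rfl fun k _ => ?_
    ring
  funext i
  refine div_piola hΦ hF (n := fun y => N y i)
    (v := fun y => (((F y).det)⁻¹ • (F y * Nhat y)) i) (hJ' x) (fun k => hu i k x) ?_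
    fun y j => hN' y i j
  intro j
  have hcomp : Differentiable ℝ (fun y => N (Φ y) i j) := by
    simp only [hN']
    exact (hdet.inv hJ').mul (Differentiable.fun_sum fun k _ => (hFd j k).mul (hu i k))
  have hfun : (fun z => N z i j) = (fun y => N (Φ y) i j) ∘ Ψ := by
    funext z
    simp only [Function.comp_apply, hright z]
  rw [hfun]
  exact (hcomp.comp (hΨ.differentiable (by norm_num))).differentiableAt
end

section
/- Let Φ : ℝ³ → ℝ³ be a C² diffeomorphism with Jacobian F(x̂) = ∇Φ(x̂) and J(x̂) = det F(x̂) > 0, let N̂ : ℝ³ → ℝ^{3×3} be continuously differentiable, set F̃ = J⁻¹·F, and define N by N(Φ(x̂)) = J(x̂)⁻²·F(x̂)·N̂(x̂)·F(x̂)ᵀ. Then for every x̂ and every component i, (div_x N)_i(Φ(x̂)) = J⁻²·Σ_j F_{ij}·(div_x̂ N̂)_j + J⁻¹·Σ_{j,k} (∂F̃_{ik}/∂x̂_j)·N̂_{kj}. -/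
open Matrix

/-- The Piola identity: the adjugate of a matrix field with curl-free rows is divergence free. -/
lemma sum_fderiv_adjugate_eq_zero {F : (Fin 3 → ℝ) → Matrix (Fin 3) (Fin 3) ℝ} {x : Fin 3 → ℝ}
    (hd : ∀ i j, DifferentiableAt ℝ (fun y => F y i j) x)
    (hs : ∀ i j k, fderiv ℝ (fun y => F y i j) x (Pi.single k 1) =
      fderiv ℝ (fun y => F y i k) x (Pi.single j 1)) (j : Fin 3) :
    ∑ l, fderiv ℝ (fun y => (F y).adjugate l j) x (Pi.single l 1) = 0 := by
  have key : ∀ (a b c d a' b' c' d' : Fin 3) (v : Fin 3 → ℝ),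
      fderiv ℝ (fun y => F y a b * F y c d - F y a' b' * F y c' d') x v =
        F x a b * fderiv ℝ (fun y => F y c d) x v + F x c d * fderiv ℝ (fun y => F y a b) x v -
        (F x a' b' * fderiv ℝ (fun y => F y c' d') x v +
          F x c' d' * fderiv ℝ (fun y => F y a' b') x v) := by
    intro a b c d a' b' c' d' v
    rw [(((hd a b).hasFDerivAt.fun_mul (hd c d).hasFDerivAt).fun_sub
      ((hd a' b').hasFDerivAt.fun_mul (hd c' d').hasFDerivAt)).fderiv]
    simp
  simp only [adjugate_fin_three, Fin.sum_univ_three]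
  fin_cases j <;> simp [neg_add_eq_sub, key] <;>
    simp only [hs _ 1 0, hs _ 2 0, hs _ 2 1] <;> ring

/-- The divergence of a vector field, pulled back along a differentiable map. -/
lemma det_mul_sum_fderiv {Φ : (Fin 3 → ℝ) → (Fin 3 → ℝ)}
    {F : (Fin 3 → ℝ) → Matrix (Fin 3) (Fin 3) ℝ} {x : Fin 3 → ℝ}
    (hΦ : DifferentiableAt ℝ Φ x)
    (hF : ∀ i j, F x i j = fderiv ℝ Φ x (Pi.single j 1) i)
    (hd : ∀ i j, DifferentiableAt ℝ (fun y => F y i j) x)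
    (hs : ∀ i j k, fderiv ℝ (fun y => F y i j) x (Pi.single k 1) =
      fderiv ℝ (fun y => F y i k) x (Pi.single j 1))
    {u : (Fin 3 → ℝ) → (Fin 3 → ℝ)} (hu : ∀ j, DifferentiableAt ℝ (fun z => u z j) (Φ x)) :
    (F x).det * ∑ j, fderiv ℝ (fun z => u z j) (Φ x) (Pi.single j 1) =
      ∑ l, fderiv ℝ (fun y => ∑ j, (F y).adjugate l j * u (Φ y) j) x (Pi.single l 1) := by
  have hadj : ∀ l j, DifferentiableAt ℝ (fun y => (F y).adjugate l j) x := by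
    intro l j
    simp only [adjugate_fin_three]
    fin_cases l <;> fin_cases j <;> simp <;> fun_prop
  have hchain : ∀ j l, fderiv ℝ (fun y => u (Φ y) j) x (Pi.single l 1) =
      ∑ m, F x m l * fderiv ℝ (fun z => u z j) (Φ x) (Pi.single m 1) := by
    intro j l
    rw [show fderiv ℝ (fun y => u (Φ y) j) x = _ from fderiv_comp x (hu j) hΦ,
      ContinuousLinearMap.comp_apply, ← Finset.univ_sum_single (fderiv ℝ Φ x (Pi.single l 1)),
      map_sum]
    refine Finset.sum_congr rfl fun m _ => ?_
    rw [hF, ← smul_eq_mul, ← map_smul, ← Pi.single_smul, smul_eq_mul, mul_one]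
  have hc : ∀ j, DifferentiableAt ℝ (fun y => u (Φ y) j) x := fun j => (hu j).comp x hΦ
  have hprod : ∀ l, fderiv ℝ (fun y => ∑ j, (F y).adjugate l j * u (Φ y) j) x (Pi.single l 1) =
      ∑ j, ((F x).adjugate l j * fderiv ℝ (fun y => u (Φ y) j) x (Pi.single l 1) +
        u (Φ x) j * fderiv ℝ (fun y => (F y).adjugate l j) x (Pi.single l 1)) := by
    intro l
    rw [(HasFDerivAt.fun_sum fun j _ => (hadj l j).hasFDerivAt.fun_mul
      (hc j).hasFDerivAt).fderiv]
    simp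
  have hmul : ∀ m j, ∑ l, F x m l * (F x).adjugate l j = if m = j then (F x).det else 0 := by
    intro m j
    rw [← mul_apply, mul_adjugate, Matrix.smul_apply, one_apply, smul_eq_mul, mul_ite, mul_one, mul_zero]
  calc (F x).det * ∑ j, fderiv ℝ (fun z => u z j) (Φ x) (Pi.single j 1)
      = ∑ j, ∑ m, (∑ l, F x m l * (F x).adjugate l j) *
          fderiv ℝ (fun z => u z j) (Φ x) (Pi.single m 1) := by
        simp [hmul, Finset.mul_sum]
    _ = ∑ l, ∑ j, (F x).adjugate l j * fderiv ℝ (fun y => u (Φ y) j) x (Pi.single l 1) := by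
        simp only [hchain, Finset.sum_mul, Finset.mul_sum]
        rw [Finset.sum_comm' (t' := Finset.univ) (s' := fun _ => Finset.univ) (by simp)]
        simp only [Fin.sum_univ_three]
        ring
    _ = _ := by
        simp only [hprod, Finset.sum_add_distrib]
        rw [left_eq_add, Finset.sum_comm]
        simp only [← Finset.mul_sum, sum_fderiv_adjugate_eq_zero hd hs, mul_zero,
          Finset.sum_const_zero]

/-- Componentwise divergence formula for the transformed stress shape function:
(div_x N)_i(Φ(x̂)) = J⁻²·Σ_j F_ij·(div_x̂ N̂)_j + J⁻¹·Σ_{j,k} ∂F̃_ik/∂x̂_j · N̂_kj,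
where F̃ = J⁻¹·F. -/
theorem stmt8 (Φ Ψ : (Fin 3 → ℝ) → (Fin 3 → ℝ))
    (hΦ : ContDiff ℝ 2 Φ) (hΨ : ContDiff ℝ 2 Ψ)
    (hleft : Function.LeftInverse Ψ Φ) (hright : Function.RightInverse Ψ Φ)
    (F : (Fin 3 → ℝ) → Matrix (Fin 3) (Fin 3) ℝ)
    (hF : ∀ x i j, F x i j = fderiv ℝ Φ x (Pi.single j 1) i)
    (hJ : ∀ x, 0 < (F x).det)
    (Nhat : (Fin 3 → ℝ) → Matrix (Fin 3) (Fin 3) ℝ)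
    (hNhat : ContDiff ℝ 1 fun x => Matrix.of.symm (Nhat x))
    (N : (Fin 3 → ℝ) → Matrix (Fin 3) (Fin 3) ℝ)
    (hN : ∀ x, N (Φ x) = (((F x).det) ^ 2)⁻¹ • (F x * Nhat x * (F x)ᵀ))
    (x : Fin 3 → ℝ) (i : Fin 3) :
    ∑ j, fderiv ℝ (fun y => N y i j) (Φ x) (Pi.single j 1) =
      (((F x).det) ^ 2)⁻¹ *
          (∑ j, F x i j * ∑ k, fderiv ℝ (fun y => Nhat y j k) x (Pi.single k 1)) +
        ((F x).det)⁻¹ *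
          ∑ j, ∑ k,
            fderiv ℝ (fun y => (((F y).det)⁻¹ • F y) i k) x (Pi.single j 1) *
              Nhat x k j := by
  have hFe : ∀ i j, (fun y => F y i j) = fun y => fderiv ℝ Φ y (Pi.single j 1) i :=
    fun i j => funext fun y => hF y i j
  have hΦd : Differentiable ℝ Φ := hΦ.differentiable (by norm_num)
  have hΦ' : Differentiable ℝ (fderiv ℝ Φ) :=
    (hΦ.fderiv_right (m := 1) (by norm_num)).differentiable (by norm_num)
  have hd : ∀ i j, Differentiable ℝ (fun y => F y i j) := by
    intro i j
    rw [hFe]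
    fun_prop
  have hfd : ∀ x i j (v : Fin 3 → ℝ), fderiv ℝ (fun y => F y i j) x v =
      fderiv ℝ (fderiv ℝ Φ) x v (Pi.single j 1) i := by
    intro x i j v
    rw [hFe]
    have h1 : HasFDerivAt (fun y => fderiv ℝ Φ y (Pi.single j 1))
        ((fderiv ℝ (fderiv ℝ Φ) x).flip (Pi.single j 1)) x := by
      simpa using (hΦ' x).hasFDerivAt.clm_apply (hasFDerivAt_const (Pi.single j 1) x)
    rw [((hasFDerivAt_pi'.1 h1) i).fderiv]
    simp
  have hs : ∀ i j k, fderiv ℝ (fun y => F y i j) x (Pi.single k 1) =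
      fderiv ℝ (fun y => F y i k) x (Pi.single j 1) := by
    intro i j k
    rw [hfd, hfd, (hΦ.contDiffAt.isSymmSndFDerivAt (by simp)).eq]
  have hdet : Differentiable ℝ fun y => (F y).det := by
    simp only [det_fin_three]
    fun_prop
  have hJ' : ∀ y, (F y).det ≠ 0 := fun y => (hJ y).ne'
  have hNd : ∀ i j, Differentiable ℝ fun y => Nhat y i j := by
    intro i j
    exact differentiable_pi.1 (differentiable_pi.1 (hNhat.differentiable (by norm_num)) i) j
  have hΨd : Differentiable ℝ Ψ := hΨ.differentiable (by norm_num)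
  have hNz : ∀ j, Differentiable ℝ fun z => N z i j := by
    intro j
    have h1 : (fun z => N z i j) = (fun y => (((F y).det) ^ 2)⁻¹ *
        ∑ l, (∑ k, F y i k * Nhat y k l) * F y j l) ∘ Ψ := by
      funext z
      conv_lhs => rw [← hright z, hN]
      simp [mul_apply]
    rw [h1]
    refine Differentiable.comp ?_ hΨd
    have h2 := (hdet.pow 2).fun_inv fun y => pow_ne_zero 2 (hJ' y)
    exact h2.fun_mul (by fun_prop)
  have hP : ∀ l y, ∑ j, (F y).adjugate l j * N (Φ y) i j =
      ∑ k, (((F y).det)⁻¹ • F y) i k * Nhat y k l := by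
    intro l y
    have h1 : N (Φ y) * ((F y).adjugate)ᵀ = ((F y).det)⁻¹ • F y * Nhat y := by
      rw [hN, smul_mul, Matrix.mul_assoc, ← transpose_mul, adjugate_mul, transpose_smul,
        transpose_one, Matrix.mul_smul, Matrix.mul_one, smul_smul, smul_mul]
      congr 1
      field_simp [hJ' y]
    simpa [mul_apply, mul_comm] using congrFun (congrFun h1 i) l
  have hFt : ∀ i k, Differentiable ℝ fun y => (((F y).det)⁻¹ • F y) i k := by
    intro i k
    exact (hdet.fun_inv hJ').fun_mul (hd i k)
  have hprod : ∀ l, fderiv ℝ (fun y => ∑ k, (((F y).det)⁻¹ • F y) i k * Nhat y k l) x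
      (Pi.single l 1) = ∑ k, ((((F x).det)⁻¹ • F x) i k *
        fderiv ℝ (fun y => Nhat y k l) x (Pi.single l 1) +
        Nhat x k l * fderiv ℝ (fun y => (((F y).det)⁻¹ • F y) i k) x (Pi.single l 1)) := by
    intro l
    rw [(HasFDerivAt.fun_sum fun k _ => (hFt i k x).hasFDerivAt.fun_mul
      (hNd k l x).hasFDerivAt).fderiv]
    simp
  have main := det_mul_sum_fderiv (hΦd x) (hF x) (fun i j => hd i j x) hs
    (u := fun z j => N z i j) (fun j => hNz j _)
  simp only [hP, hprod] at main
  rw [← mul_right_inj' (hJ' x), main]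
  simp only [Finset.sum_add_distrib]
  rw [mul_add, Finset.sum_comm]
  congr 1
  · rw [← mul_assoc, show (F x).det * ((F x).det ^ 2)⁻¹ = ((F x).det)⁻¹ by field_simp [hJ' x],
      Finset.mul_sum]
    simp only [Finset.mul_sum, Matrix.smul_apply, smul_eq_mul, mul_assoc]
  · rw [mul_inv_cancel_left₀ (hJ' x)]
    simp only [mul_comm]
end

section
/- Let Φ : ℝ³ → ℝ³ be a C² diffeomorphism with everywhere invertible Jacobian F(x̂) = ∇Φ(x̂), and let H^k(x̂) denote the (symmetric) Hessian matrix of the k-th component Φ_k. Let û : ℝ³ → ℝ³ be continuously differentiable and define the covariantly transformed field u by u(Φ(x̂)) = F(x̂)⁻ᵀ·û(x̂). Then for every x̂: F(x̂)ᵀ · ε(u)(Φ(x̂)) · F(x̂) = ε̂(û)(x̂) − Σ_k (F(x̂)⁻ᵀ·û(x̂))_k · H^k(x̂), where ε(u) = ½(∇_x u + ∇_x uᵀ) and ε̂(û) = ½(∇_x̂ û + ∇_x̂ ûᵀ). In particular, on curvilinear (non-affine) elements the strain of a transformed shape function depends not only on the reference strain but also on the values of the shape function, and the extra term vanishes whenever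 F is constant. -/
open Matrix

/-- The components of the derivative of a `C²` map are differentiable. -/
theorem differentiable_fderiv_apply_apply {ι κ : Type*} [Fintype ι] [Fintype κ]
    {Φ : (ι → ℝ) → (κ → ℝ)} (hΦ : ContDiff ℝ 2 Φ) (v : ι → ℝ) (k : κ) :
    Differentiable ℝ fun y => fderiv ℝ Φ y v k := by
  have h : Differentiable ℝ fun y => fderiv ℝ Φ y v :=
    ((hΦ.fderiv_right (m := 1) (by norm_num)).differentiable (by norm_num)).clm_apply
      (differentiable_const v)
  exact differentiable_pi.1 h k

/-- Second directional derivatives of the components of a `C²` map commute. -/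
theorem fderiv_fderiv_apply_apply_comm {ι κ : Type*} [Fintype ι] [Fintype κ]
    {Φ : (ι → ℝ) → (κ → ℝ)} (hΦ : ContDiff ℝ 2 Φ) (x v w : ι → ℝ) (k : κ) :
    fderiv ℝ (fun y => fderiv ℝ Φ y v k) x w = fderiv ℝ (fun y => fderiv ℝ Φ y w k) x v := by
  have hd : DifferentiableAt ℝ (fderiv ℝ Φ) x :=
    (hΦ.fderiv_right (m := 1) (by norm_num)).differentiable (by norm_num) x
  have h : ∀ a b : ι → ℝ,
      fderiv ℝ (fun y => fderiv ℝ Φ y a k) x b = fderiv ℝ (fderiv ℝ Φ) x b a k := by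
    intro a b
    have h1 := hd.hasFDerivAt.clm_apply (hasFDerivAt_const a x)
    rw [(hasFDerivAt_pi'.1 h1 k).fderiv]
    simp
  rw [h, h]
  exact congrFun ((hΦ.contDiffAt.isSymmSndFDerivAt (by simp)).eq w v) k

/-- The derivative of a map between coordinate spaces, expanded in partial derivatives. -/
theorem fderiv_apply_eq_sum_single {ι E : Type*} [Fintype ι] [DecidableEq ι]
    [NormedAddCommGroup E] [NormedSpace ℝ E] (L : (ι → ℝ) →L[ℝ] E) (v : ι → ℝ) :
    L v = ∑ l, v l • L (Pi.single l 1) := by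
  conv_lhs => rw [pi_eq_sum_univ' v]
  simp [map_sum]

/-- The inverse Jacobian of a diffeomorphism is the Jacobian of the inverse map. -/
theorem inv_jacobian_apply {ι : Type*} [Fintype ι] [DecidableEq ι] {Φ Ψ : (ι → ℝ) → (ι → ℝ)}
    (hΦ : Differentiable ℝ Φ) (hΨ : Differentiable ℝ Ψ) (hleft : Function.LeftInverse Ψ Φ)
    {F : (ι → ℝ) → Matrix ι ι ℝ} (hF : ∀ x i j, F x i j = fderiv ℝ Φ x (Pi.single j 1) i)
    (x : ι → ℝ) (i j : ι) :
    (F x)⁻¹ i j = fderiv ℝ Ψ (Φ x) (Pi.single j 1) i := by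
  have h : (Matrix.of fun i j => fderiv ℝ Ψ (Φ x) (Pi.single j 1) i) * F x = 1 := by
    ext a b
    have hc := fderiv_comp x (hΨ (Φ x)) (hΦ x)
    rw [hleft.comp_eq_id, fderiv_id] at hc
    have hcb := congrFun (DFunLike.congr_fun hc (Pi.single b 1)) a
    rw [ContinuousLinearMap.comp_apply, fderiv_apply_eq_sum_single (fderiv ℝ Ψ (Φ x))] at hcb
    simp only [ContinuousLinearMap.id_apply, Finset.sum_apply, Pi.smul_apply, smul_eq_mul,
      ← hF] at hcb
    rw [Matrix.mul_apply, Matrix.one_apply, ← Pi.single_apply, hcb]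
    exact Finset.sum_congr rfl fun l _ => mul_comm _ _
  rw [Matrix.inv_eq_left_inv h, Matrix.of_apply]

/-- The covariant transform of a `C¹` field under a `C²` diffeomorphism is differentiable. -/
theorem differentiable_covariant {ι : Type*} [Fintype ι] [DecidableEq ι]
    {Φ Ψ : (ι → ℝ) → (ι → ℝ)} (hΦ : Differentiable ℝ Φ) (hΨ : ContDiff ℝ 2 Ψ)
    (hleft : Function.LeftInverse Ψ Φ) (hright : Function.RightInverse Ψ Φ)
    {F : (ι → ℝ) → Matrix ι ι ℝ} (hF : ∀ x i j, F x i j = fderiv ℝ Φ x (Pi.single j 1) i)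
    {uhat u : (ι → ℝ) → (ι → ℝ)} (huhat : Differentiable ℝ uhat)
    (hu : ∀ x, u (Φ x) = ((F x)⁻¹)ᵀ *ᵥ uhat x) (k : ι) :
    Differentiable ℝ fun z => u z k := by
  have hΨd : Differentiable ℝ Ψ := hΨ.differentiable (by norm_num)
  have h : (fun z => u z k) =
      fun z => ∑ l, fderiv ℝ Ψ z (Pi.single k 1) l * uhat (Ψ z) l := by
    funext z
    have hz := congrFun (hu (Ψ z)) k
    rw [hright z] at hz
    simp only [hz, Matrix.mulVec, dotProduct, Matrix.transpose_apply,
      inv_jacobian_apply hΦ hΨd hleft hF, hright z]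
  rw [h]
  exact Differentiable.fun_sum fun l _ => (differentiable_fderiv_apply_apply hΨ _ l).mul
    ((differentiable_pi.1 huhat l).comp hΨd)

/-- Partial derivatives of the pullback `Fᵀ (u ∘ Φ)`. -/
theorem fderiv_pullback_apply {ι : Type*} [Fintype ι] [DecidableEq ι]
    {Φ : (ι → ℝ) → (ι → ℝ)} (hΦ : ContDiff ℝ 2 Φ) {u : (ι → ℝ) → (ι → ℝ)}
    (hu : ∀ k, Differentiable ℝ fun z => u z k) (x : ι → ℝ) (i j : ι) :
    fderiv ℝ (fun y => ∑ k, fderiv ℝ Φ y (Pi.single i 1) k * u (Φ y) k) x (Pi.single j 1) =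
      ∑ k, (fderiv ℝ (fun y => fderiv ℝ Φ y (Pi.single i 1) k) x (Pi.single j 1) * u (Φ x) k +
        fderiv ℝ Φ x (Pi.single i 1) k * ∑ l, fderiv ℝ Φ x (Pi.single j 1) l *
          fderiv ℝ (fun z => u z k) (Φ x) (Pi.single l 1)) := by
  have h := HasFDerivAt.fun_sum (u := Finset.univ) fun k _ =>
    (differentiable_fderiv_apply_apply hΦ (Pi.single i 1) k x).hasFDerivAt.mul
      ((hu k (Φ x)).hasFDerivAt.comp x (hΦ.differentiable (by norm_num) x).hasFDerivAt)
  refine (DFunLike.congr_fun h.fderiv _).trans ?_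
  rw [_root_.sum_apply]
  refine Finset.sum_congr rfl fun k _ => ?_
  simp only [_root_.add_apply, _root_.smul_apply,
    ContinuousLinearMap.comp_apply, smul_eq_mul, Function.comp_apply]
  rw [fderiv_apply_eq_sum_single (fderiv ℝ (fun z => u z k) (Φ x))]
  simp only [smul_eq_mul]
  ring



/-- Strain transformation on curvilinear elements: for the covariantly
transformed field u∘Φ = F⁻ᵀ·û one has
Fᵀ·ε(u)∘Φ·F = ε̂(û) − Σ_k (F⁻ᵀ·û)_k · H^k, with H^k the Hessian of Φ_k. -/
theorem stmt9 (Φ Ψ : (Fin 3 → ℝ) → (Fin 3 → ℝ))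
    (hΦ : ContDiff ℝ 2 Φ) (hΨ : ContDiff ℝ 2 Ψ)
    (hleft : Function.LeftInverse Ψ Φ) (hright : Function.RightInverse Ψ Φ)
    (F : (Fin 3 → ℝ) → Matrix (Fin 3) (Fin 3) ℝ)
    (hF : ∀ x i j, F x i j = fderiv ℝ Φ x (Pi.single j 1) i)
    (hFinv : ∀ x, IsUnit (F x).det)
    (uhat : (Fin 3 → ℝ) → (Fin 3 → ℝ)) (huhat : ContDiff ℝ 1 uhat)
    (u : (Fin 3 → ℝ) → (Fin 3 → ℝ))
    (hu : ∀ x, u (Φ x) = ((F x)⁻¹)ᵀ *ᵥ uhat x)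
    (x : Fin 3 → ℝ) :
    (F x)ᵀ *
        (Matrix.of fun i j => (1 / 2 : ℝ) *
          (fderiv ℝ (fun y => u y i) (Φ x) (Pi.single j 1) +
            fderiv ℝ (fun y => u y j) (Φ x) (Pi.single i 1))) * F x =
      (Matrix.of fun i j => (1 / 2 : ℝ) *
          (fderiv ℝ (fun y => uhat y i) x (Pi.single j 1) +
            fderiv ℝ (fun y => uhat y j) x (Pi.single i 1))) -
        ∑ k, (((F x)⁻¹)ᵀ *ᵥ uhat x) k •
          (Matrix.of fun i j =>
            fderiv ℝ (fun y => fderiv ℝ Φ y (Pi.single j 1) k) x (Pi.single i 1)) := by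
  have hΦd : Differentiable ℝ Φ := hΦ.differentiable (by norm_num)
  have hud : ∀ k, Differentiable ℝ fun z => u z k :=
    differentiable_covariant hΦd hΨ hleft hright hF (huhat.differentiable (by norm_num)) hu
  have hpull : ∀ i, (fun y => uhat y i) =
      fun y => ∑ k, fderiv ℝ Φ y (Pi.single i 1) k * u (Φ y) k := by
    intro i
    funext y
    have h : (F y)ᵀ *ᵥ u (Φ y) = uhat y := by
      rw [hu, Matrix.mulVec_mulVec, ← Matrix.transpose_mul, Matrix.nonsing_inv_mul _ (hFinv y),
        Matrix.transpose_one, Matrix.one_mulVec]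
    rw [← h]
    simp only [Matrix.mulVec, dotProduct, Matrix.transpose_apply, hF]
  ext i j
  rw [← hu]
  simp only [Matrix.mul_apply, Matrix.sub_apply, Matrix.of_apply, Matrix.sum_apply,
    Matrix.smul_apply, Matrix.transpose_apply, smul_eq_mul, hpull,
    fderiv_pullback_apply hΦ hud, hF]
  simp only [fderiv_fderiv_apply_apply_comm hΦ x (Pi.single i 1) (Pi.single j 1),
    Fin.sum_univ_three]
  ring
end
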